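/- If the utility functions u_i are continuous, strictly monotonic, non-satiable, and perfectly complementary for all i, then there exists an allocation with the 'No Justified Complaints' property (a bottleneck-based fair allocation). -/

import Mathlib

open scoped NNReal

abbrev Bundle (m : ℕ) := Fin m → ℝ≥0

def Parsimonious {m : ℕ} (u : Bundle m → ℝ) (x : Bundle m) : Prop :=
  ∀ z : Bundle m, z ≤ x → z ≠ x → u z < u x

def PerfComp {m : ℕ} (u : Bundle m → ℝ) : Prop :=
  ∀ x y : Bundle m, u (x ⊓ y) = min (u x) (u y)

def NonSatiableStrictMono {m : ℕ} (u : Bundle m → ℝ) : Prop :=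
  (∀ x : Bundle m, ∃ y : Bundle m, u x < u y) ∧
  (∀ x y : Bundle m, (∀ j, x j < y j) → u x < u y)

/-- `x` is maximal for `u` if it achieves the greatest utility. -/
def Maximal' {m : ℕ} (u : Bundle m → ℝ) (x : Bundle m) : Prop :=
  ∀ y : Bundle m, u y ≤ u x

/-- A set `S` is dominating for the family of rankings `r` if no element exceeds, in every ranking,
the minimum of `S`. -/
def Dominating {T I : Type*} (r : I → T → ℕ) (S : Finset T) : Prop :=
  ∀ y, ∃ i, ∀ x ∈ S, r i y ≤ r i x

theorem Dominating.mono {T I : Type*} {r : I → T → ℕ} {S S' : Finset T} (h : Dominating r S)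
    (hs : S' ⊆ S) : Dominating r S' := fun y => by
  obtain ⟨i, hi⟩ := h y
  exact ⟨i, fun x hx => hi x (hs hx)⟩

/-- `y` is the `r a`-greatest among the elements exceeding `μ i` in every ranking `i ≠ a`. -/
def IsGreatestAbove {T I : Type*} (r : I → T → ℕ) (μ : I → T) (a : I) (y : T) : Prop :=
  (∀ i, i ≠ a → r i (μ i) < r i y) ∧ ∀ z, (∀ i, i ≠ a → r i (μ i) < r i z) → r a z ≤ r a y

theorem IsGreatestAbove.dominating_insert {T I : Type*} [DecidableEq T] {r : I → T → ℕ}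
    {τ : Finset T} (hdom : Dominating r τ) {μ : I → T} (hμ : ∀ i, μ i ∈ τ)
    (hmin : ∀ i, ∀ x ∈ τ, r i (μ i) ≤ r i x) {a : I} (hsurj : ∀ x ∈ τ, ∃ i, i ≠ a ∧ μ i = x)
    {y : T} (hy : IsGreatestAbove r μ a y) : y ∉ τ ∧ Dominating r (insert y τ) := by
  obtain ⟨h1, h2⟩ := hy
  refine ⟨fun hyτ => ?_, fun z => ?_⟩
  · obtain ⟨i, hia, hi⟩ := hsurj y hyτ
    have := h1 i hia
    rw [hi] at this
    exact lt_irrefl _ this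
  · by_cases hz : ∀ i, i ≠ a → r i (μ i) < r i z
    · obtain ⟨i, hi⟩ := hdom z
      have hia : i = a := by
        by_contra hia
        exact absurd (hi _ (hμ i)) (not_le.2 (hz i hia))
      subst hia
      refine ⟨i, fun x hx => ?_⟩
      rcases Finset.mem_insert.1 hx with rfl | hx
      · exact h2 z hz
      · exact hi x hx
    · push Not at hz
      obtain ⟨i, hia, hi⟩ := hz
      refine ⟨i, fun x hx => ?_⟩
      rcases Finset.mem_insert.1 hx with rfl | hx
      · exact hi.trans (h1 i hia).le
      · exact hi.trans (hmin i x hx)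

theorem Dominating.isGreatestAbove_of_insert {T I : Type*} [DecidableEq T] {r : I → T → ℕ}
    (hr : ∀ i, Function.Injective (r i)) {τ : Finset T} {μ : I → T} (hμ : ∀ i, μ i ∈ τ)
    (hmin : ∀ i, ∀ x ∈ τ, r i (μ i) ≤ r i x) {a b : I} (hab : a ≠ b) (hμab : μ a = μ b)
    (ha : ∀ i j, i ≠ a → j ≠ a → μ i = μ j → i = j)
    (hb : ∀ i j, i ≠ b → j ≠ b → μ i = μ j → i = j)
    {y : T} (hy : y ∉ τ) (hdom : Dominating r (insert y τ)) :
    IsGreatestAbove r μ a y ∨ IsGreatestAbove r μ b y := by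
  obtain ⟨k, hk⟩ := hdom y
  have key : ∀ x ∈ τ, ∃ i, i ≠ k ∧ μ i = x ∧ r i x ≤ r i y := by
    intro x hx
    obtain ⟨i, hi⟩ := hdom x
    refine ⟨i, ?_, ?_, hi y (Finset.mem_insert_self _ _)⟩
    · rintro rfl
      have : x = y := hr i (le_antisymm (hi y (Finset.mem_insert_self _ _))
        (hk x (Finset.mem_insert_of_mem hx)))
      exact hy (this ▸ hx)
    · exact hr i (le_antisymm (hmin i x hx) (hi _ (Finset.mem_insert_of_mem (hμ i))))
  have main : (∀ i j, i ≠ k → j ≠ k → μ i = μ j → i = j) → IsGreatestAbove r μ k y := by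
    intro hinj
    have hlt : ∀ i, i ≠ k → r i (μ i) < r i y := by
      intro i hik
      obtain ⟨i', hi'k, hi', hle⟩ := key (μ i) (hμ i)
      obtain rfl := hinj i' i hi'k hik hi'
      refine lt_of_le_of_ne hle fun h => hy ?_
      rw [← hr _ h]
      exact hμ _
    refine ⟨hlt, fun z hz => ?_⟩
    obtain ⟨i, hi⟩ := hdom z
    have hik : i = k := by
      by_contra hik
      exact absurd (hi _ (Finset.mem_insert_of_mem (hμ i))) (not_le.2 (hz i hik))
    subst hik
    exact hi y (Finset.mem_insert_self _ _)
  by_cases hka : k = a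
  · subst hka
    exact Or.inl (main ha)
  by_cases hkb : k = b
  · subst hkb
    exact Or.inr (main hb)
  exfalso
  obtain ⟨i, hik, hi, -⟩ := key (μ k) (hμ k)
  by_cases hia : i = a
  · subst hia
    exact hkb (ha k b hka hab.symm (hi.symm.trans hμab))
  · exact hik (ha i k hia hka hi)

/-- A dominating set with one element less than there are rankings has exactly two dominating
one-element extensions, provided that it is not on the boundary. -/
theorem Dominating.card_extensions {T I : Type*} [Fintype T] [DecidableEq T] [Fintype I]
    [DecidableEq I] {r : I → T → ℕ} (hr : ∀ i, Function.Injective (r i)) {τ : Finset T}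
    (hdom : Dominating r τ) (hcard : τ.card + 1 = Fintype.card I) (hne : τ.Nonempty)
    (habove : ∀ a, ∃ y, ∀ i, i ≠ a → ∃ x ∈ τ, r i x < r i y)
    {E : Finset T} (hE : ∀ y, y ∈ E ↔ y ∉ τ ∧ Dominating r (insert y τ)) : E.card = 2 := by
  have hex : ∀ i, ∃ x ∈ τ, ∀ x' ∈ τ, r i x ≤ r i x' := fun i => τ.exists_min_image (r i) hne
  choose μ hμ hmin using hex
  have hsurj0 : ∀ x ∈ τ, ∃ i, μ i = x := by
    intro x hx
    obtain ⟨i, hi⟩ := hdom x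
    exact ⟨i, hr i (le_antisymm (hmin i x hx) (hi _ (hμ i)))⟩
  obtain ⟨a, -, b, -, hab, hμab⟩ := Finset.exists_ne_map_eq_of_card_lt_of_maps_to
    (s := Finset.univ) (t := τ) (f := μ) (by rw [Finset.card_univ]; omega) (fun i _ => hμ i)
  have gen : ∀ a b, a ≠ b → μ a = μ b → (∀ x ∈ τ, ∃ i, i ≠ a ∧ μ i = x) ∧
      (∀ i j, i ≠ a → j ≠ a → μ i = μ j → i = j) ∧ ∃ y, IsGreatestAbove r μ a y := by
    intro a b hab hμab
    have hs : ∀ x ∈ τ, ∃ i, i ≠ a ∧ μ i = x := by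
      intro x hx
      obtain ⟨i, hi⟩ := hsurj0 x hx
      by_cases hia : i = a
      · exact ⟨b, hab.symm, by rw [← hμab, ← hia, hi]⟩
      · exact ⟨i, hia, hi⟩
    refine ⟨hs, ?_, ?_⟩
    · have himg : (Finset.univ.erase a).image μ = τ := by
        ext x
        simp only [Finset.mem_image, Finset.mem_erase, Finset.mem_univ, and_true]
        constructor
        · rintro ⟨i, -, rfl⟩
          exact hμ i
        · exact hs x
      have hinj : Set.InjOn μ (Finset.univ.erase a : Finset I) := by
        rw [← Finset.card_image_iff, himg, Finset.card_erase_of_mem (Finset.mem_univ a),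
          Finset.card_univ]
        omega
      intro i j hi hj hij
      exact hinj (by simpa using hi) (by simpa using hj) hij
    · obtain ⟨y, hy⟩ := habove a
      obtain ⟨w, hw, hwmax⟩ :=
        (Finset.univ.filter fun y => ∀ i, i ≠ a → r i (μ i) < r i y).exists_max_image (r a)
          ⟨y, by
            simp only [Finset.mem_filter, Finset.mem_univ, true_and]
            intro i hi
            obtain ⟨x, hx, hlt⟩ := hy i hi
            exact (hmin i x hx).trans_lt hlt⟩
      simp only [Finset.mem_filter, Finset.mem_univ, true_and] at hw hwmax
      exact ⟨w, hw, hwmax⟩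
  obtain ⟨hsa, hia, ya, hya⟩ := gen a b hab hμab
  obtain ⟨hsb, hib, yb, hyb⟩ := gen b a hab.symm hμab.symm
  rw [Finset.card_eq_two]
  refine ⟨ya, yb, ?_, ?_⟩
  · rintro rfl
    obtain ⟨i, hi⟩ := hdom ya
    have hle := hi _ (hμ i)
    by_cases h : i = a
    · subst h
      exact absurd hle (not_le.2 (hyb.1 i hab))
    · exact absurd hle (not_le.2 (hya.1 i h))
  · ext y
    rw [hE, Finset.mem_insert, Finset.mem_singleton]
    constructor
    · rintro ⟨hy, hd⟩
      rcases hd.isGreatestAbove_of_insert hr hμ hmin hab hμab hia hib hy with h | h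
      · exact Or.inl (hr a (le_antisymm (hya.2 y h.1) (h.2 ya hya.1)))
      · exact Or.inr (hr b (le_antisymm (hyb.2 y h.1) (h.2 yb hyb.1)))
    · rintro (rfl | rfl)
      · exact hya.dominating_insert hdom hμ hmin hsa
      · exact hyb.dominating_insert hdom hμ hmin hsb

/-- If a set of `card I` points misses some colour, an even number of its elements can be deleted
so that exactly the colours other than `i₀` remain. -/
theorem even_card_deletions {T I : Type*} [DecidableEq T] [Fintype I] [DecidableEq I] (c : T → I)
    (i₀ : I) {S : Finset T} (hcard : S.card = Fintype.card I) (hS : S.image c ≠ Finset.univ) :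
    Even (S.filter fun x => (S.erase x).image c = Finset.univ.erase i₀).card := by
  rcases Finset.eq_empty_or_nonempty
    (S.filter fun x => (S.erase x).image c = Finset.univ.erase i₀) with h | ⟨x, hx⟩
  · rw [h]
    simp
  rw [Finset.mem_filter] at hx
  obtain ⟨hxS, himg⟩ := hx
  have hinj : Set.InjOn c (S.erase x : Finset T) := by
    rw [← Finset.card_image_iff, himg, Finset.card_erase_of_mem (Finset.mem_univ _),
      Finset.card_erase_of_mem hxS, hcard, Finset.card_univ]
  have hSx : S.image c = insert (c x) (Finset.univ.erase i₀) := by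
    rw [← himg, ← Finset.image_insert, Finset.insert_erase hxS]
  have hcx : c x ≠ i₀ := by
    intro h
    apply hS
    rw [hSx, h, Finset.insert_erase (Finset.mem_univ _)]
  have : c x ∈ (S.erase x).image c := by
    rw [himg]
    simpa using hcx
  obtain ⟨x', hx', hcx'⟩ := Finset.mem_image.1 this
  have hx'x : x' ≠ x := Finset.ne_of_mem_erase hx'
  have hx'S : x' ∈ S := Finset.mem_of_mem_erase hx'
  have hpair : (S.filter fun x => (S.erase x).image c = Finset.univ.erase i₀) = {x, x'} := by
    ext z
    rw [Finset.mem_filter, Finset.mem_insert, Finset.mem_singleton]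
    constructor
    · rintro ⟨hz, hzimg⟩
      by_contra! hne
      have hcz : c z ∈ (S.erase z).image c := by
        rw [hzimg, ← himg]
        exact Finset.mem_image_of_mem c (Finset.mem_erase.2 ⟨hne.1, hz⟩)
      obtain ⟨w, hw, hcw⟩ := Finset.mem_image.1 hcz
      have hwz := Finset.ne_of_mem_erase hw
      have hwS := Finset.mem_of_mem_erase hw
      by_cases hwx : w = x
      · subst hwx
        exact hne.2 (hinj (Finset.mem_coe.2 (Finset.mem_erase.2 ⟨hne.1, hz⟩))
          (Finset.mem_coe.2 hx') (hcw.symm.trans hcx'.symm))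
      · exact hwz (hinj (Finset.mem_coe.2 (Finset.mem_erase.2 ⟨hwx, hwS⟩))
          (Finset.mem_coe.2 (Finset.mem_erase.2 ⟨hne.1, hz⟩)) hcw)
    · rintro (rfl | rfl)
      · exact ⟨hxS, himg⟩
      · refine ⟨hx'S, ?_⟩
        rw [← himg]
        ext j
        simp only [Finset.mem_image, Finset.mem_erase]
        constructor
        · rintro ⟨w, ⟨hw, hwS⟩, rfl⟩
          by_cases hwx : w = x
          · exact ⟨z, ⟨hx'x, hx'S⟩, by rw [hcx', hwx]⟩
          · exact ⟨w, ⟨hwx, hwS⟩, rfl⟩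
        · rintro ⟨w, ⟨hw, hwS⟩, rfl⟩
          by_cases hwx : w = z
          · exact ⟨x, ⟨hx'x.symm, hxS⟩, by rw [← hcx', hwx]⟩
          · exact ⟨w, ⟨hwx, hwS⟩, rfl⟩
  rw [hpair, Finset.card_pair hx'x.symm]
  exact even_two

/-- **Scarf's lemma** (parity form of Sperner's lemma for families of rankings): if the elements
`e i` are extremal and `e i` has colour `i`, some dominating set carries all colours. -/
theorem exists_dominating_image_eq_univ {W I : Type*} [Fintype W] [DecidableEq W] [Fintype I]
    [DecidableEq I] [Nonempty I] {r : I → W → ℕ} (hr : ∀ i, Function.Injective (r i)) (c : W → I)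
    (e : I → W) (hce : ∀ i, c (e i) = i) (hlow : ∀ i x, x ≠ e i → r i (e i) < r i x)
    (hhigh : ∀ i k x, k ≠ i → (∀ l, x ≠ e l) → r i x < r i (e k))
    (hne : ∃ x, ∀ l, x ≠ e l) :
    ∃ S : Finset W, Dominating r S ∧ S.image c = Finset.univ := by
  classical
  by_contra! hno
  obtain ⟨i₀⟩ := ‹Nonempty I›
  have hlow' : ∀ i x, r i (e i) ≤ r i x := fun i x => by
    by_cases h : x = e i
    · rw [h]
    · exact (hlow i x h).le
  set Q : Finset (Finset W × W) := Finset.univ.filter fun p =>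
    Dominating r p.1 ∧ p.1.card = Fintype.card I ∧ p.2 ∈ p.1 ∧
      (p.1.erase p.2).image c = Finset.univ.erase i₀ with hQ
  have hmemQ : ∀ p, p ∈ Q ↔ Dominating r p.1 ∧ p.1.card = Fintype.card I ∧ p.2 ∈ p.1 ∧
      (p.1.erase p.2).image c = Finset.univ.erase i₀ := fun p => by simp [hQ]
  have heven : Even Q.card := by
    rw [Finset.card_eq_sum_card_fiberwise (f := Prod.fst) (t := Finset.univ)
      (fun _ _ => by simp)]
    refine Finset.even_sum _ fun S _ => ?_
    by_cases hS : Dominating r S ∧ S.card = Fintype.card I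
    · have : Q.filter (fun p => p.1 = S) =
          (S.filter fun x => (S.erase x).image c = Finset.univ.erase i₀).image
            (fun x => (S, x)) := by
        ext ⟨S', x⟩
        simp only [Finset.mem_filter, hmemQ, Finset.mem_image, Prod.mk.injEq]
        constructor
        · rintro ⟨⟨-, -, hx, himg⟩, rfl⟩
          exact ⟨x, ⟨hx, himg⟩, rfl, rfl⟩
        · rintro ⟨x', ⟨hx, himg⟩, rfl, rfl⟩
          exact ⟨⟨hS.1, hS.2, hx, himg⟩, rfl⟩
      rw [this, Finset.card_image_of_injective _ (fun _ _ h => (Prod.mk.inj h).2)]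
      exact even_card_deletions c i₀ hS.2 (hno S hS.1)
    · have : Q.filter (fun p => p.1 = S) = ∅ := by
        rw [Finset.filter_eq_empty_iff]
        rintro ⟨S', x⟩ hp rfl
        rw [hmemQ] at hp
        exact hS ⟨hp.1, hp.2.1⟩
      rw [this]
      simp
  set extensions : Finset W → Finset W := fun τ =>
    Finset.univ.filter fun y => y ∉ τ ∧ Dominating r (insert y τ) with hextensions
  have hmemext : ∀ τ y, y ∈ extensions τ ↔ y ∉ τ ∧ Dominating r (insert y τ) :=
    fun τ y => by simp [hextensions]
  have hfiber : ∀ τ : Finset W, τ.card + 1 = Fintype.card I →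
      τ.image c = Finset.univ.erase i₀ →
      (Q.filter (fun p => p.1.erase p.2 = τ)).card = (extensions τ).card := by
    intro τ hcard himg
    have : Q.filter (fun p => p.1.erase p.2 = τ) =
        (extensions τ).image (fun y => (insert y τ, y)) := by
      ext ⟨S, x⟩
      simp only [Finset.mem_filter, hmemQ, Finset.mem_image, Prod.mk.injEq, hmemext]
      constructor
      · rintro ⟨⟨hd, -, hx, -⟩, rfl⟩
        refine ⟨x, ⟨Finset.notMem_erase _ _, ?_⟩, Finset.insert_erase hx, rfl⟩
        rwa [Finset.insert_erase hx]
      · rintro ⟨y, ⟨hy, hd⟩, rfl, rfl⟩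
        rw [Finset.erase_insert hy]
        exact ⟨⟨hd, by rw [Finset.card_insert_of_notMem hy, hcard],
          Finset.mem_insert_self _ _, himg⟩, rfl⟩
    rw [this, Finset.card_image_of_injective _ (fun _ _ h => (Prod.mk.inj h).2)]
  have heinj : Function.Injective e := fun i j h => by rw [← hce i, h, hce]
  set τ₀ : Finset W := (Finset.univ.erase i₀).image e with hτ₀
  have hτ₀card : τ₀.card + 1 = Fintype.card I := by
    rw [hτ₀, Finset.card_image_of_injective _ heinj,
      Finset.card_erase_add_one (Finset.mem_univ _), Finset.card_univ]
  have hτ₀img : τ₀.image c = Finset.univ.erase i₀ := by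
    rw [hτ₀, Finset.image_image]
    have : c ∘ e = id := funext hce
    rw [this, Finset.image_id]
  have hmemτ₀ : ∀ x, x ∈ τ₀ ↔ ∃ k, k ≠ i₀ ∧ e k = x := fun x => by simp [hτ₀]
  have hone : (extensions τ₀).card = 1 := by
    obtain ⟨x₀, hx₀⟩ := hne
    obtain ⟨w, hw, hwmax⟩ := (Finset.univ.filter fun x : W => ∀ l, x ≠ e l).exists_max_image (r i₀)
      ⟨x₀, by simpa using hx₀⟩
    simp only [Finset.mem_filter, Finset.mem_univ, true_and] at hw hwmax
    rw [Finset.card_eq_one]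
    refine ⟨w, ?_⟩
    ext y
    rw [hmemext, Finset.mem_singleton]
    constructor
    · rintro ⟨hy, hd⟩
      have hyi : ∀ z, (∀ l, z ≠ e l) → r i₀ z ≤ r i₀ y := by
        intro z hz
        obtain ⟨i, hi⟩ := hd z
        have : i = i₀ := by
          by_contra hii
          exact absurd (hi (e i) (Finset.mem_insert_of_mem ((hmemτ₀ _).2 ⟨i, hii, rfl⟩)))
            (not_le.2 (hlow i z (hz i)))
        subst this
        exact hi y (Finset.mem_insert_self _ _)
      have hyn : ∀ l, y ≠ e l := by
        rintro l rfl
        by_cases hl : l = i₀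
        · subst hl
          exact absurd (hyi x₀ hx₀) (not_le.2 (hlow _ _ (hx₀ _)))
        · exact hy ((hmemτ₀ _).2 ⟨l, hl, rfl⟩)
      exact hr i₀ (le_antisymm (hwmax y hyn) (hyi w hw))
    · rintro rfl
      refine ⟨fun h => ?_, fun z => ?_⟩
      · obtain ⟨k, -, hk⟩ := (hmemτ₀ _).1 h
        exact hw k hk.symm
      · by_cases hz : ∀ l, z ≠ e l
        · refine ⟨i₀, fun x hx => ?_⟩
          rcases Finset.mem_insert.1 hx with rfl | hx
          · exact hwmax z hz
          · obtain ⟨k, hk, rfl⟩ := (hmemτ₀ _).1 hx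
            exact (hhigh i₀ k z hk hz).le
        · push Not at hz
          obtain ⟨l, rfl⟩ := hz
          exact ⟨l, fun x _ => hlow' l x⟩
  have hodd : Odd Q.card := by
    rw [Finset.card_eq_sum_card_fiberwise (f := fun p : Finset W × W => p.1.erase p.2)
      (t := Finset.univ) (fun _ _ => by simp),
      ← Finset.add_sum_erase _ _ (Finset.mem_univ τ₀), hfiber τ₀ hτ₀card hτ₀img, hone]
    refine odd_one.add_even (Finset.even_sum _ fun τ hτ => ?_)
    have hτne := Finset.ne_of_mem_erase hτ
    rcases Finset.eq_empty_or_nonempty (Q.filter (fun p => p.1.erase p.2 = τ)) with h | ⟨p, hp⟩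
    · rw [h]
      simp
    obtain ⟨hpQ, hpτ⟩ := Finset.mem_filter.1 hp
    obtain ⟨hd, hcard, hp2, himg⟩ := (hmemQ p).1 hpQ
    have hτd : Dominating r τ := hpτ ▸ hd.mono (Finset.erase_subset _ _)
    have hτcard : τ.card + 1 = Fintype.card I := by
      rw [← hpτ, Finset.card_erase_add_one hp2, hcard]
    rw [hpτ] at himg
    rw [hfiber τ hτcard himg]
    have hint : ∃ x ∈ τ, ∀ l, x ≠ e l := by
      by_contra! hall
      apply hτne
      ext x
      rw [hmemτ₀]
      constructor
      · intro hx
        obtain ⟨l, rfl⟩ := hall x hx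
        refine ⟨l, ?_, rfl⟩
        have := Finset.mem_image_of_mem c hx
        rw [himg, hce] at this
        exact Finset.ne_of_mem_erase this
      · rintro ⟨k, hk, rfl⟩
        have : k ∈ τ.image c := by
          rw [himg]
          simpa using hk
        obtain ⟨x, hx, hxk⟩ := Finset.mem_image.1 this
        obtain ⟨l, rfl⟩ := hall x hx
        rw [hce] at hxk
        rwa [← hxk]
    obtain ⟨x, hx, hxe⟩ := hint
    have := hτd.card_extensions hr hτcard ⟨x, hx⟩
      (fun a => ⟨e a, fun i hi => ⟨x, hx, hhigh i a x (Ne.symm hi) hxe⟩⟩) (hmemext τ)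
    rw [this]
    exact even_two
  exact (Nat.not_even_iff_odd.2 hodd) heven

/-- Every colouring of a finite set ranked in several ways has a nonempty set which is
dominating for the rankings indexed by its own colours. -/
theorem exists_dominating_for_own_colours {T I : Type*} [Fintype T] [Nonempty T] [Fintype I]
    (r : I → T → ℕ) (hr : ∀ i, Function.Injective (r i)) (c : T → I) :
    ∃ σ : Finset T, ∀ y, ∃ x₀ ∈ σ, ∀ x ∈ σ, r (c x₀) y ≤ r (c x₀) x := by
  classical
  obtain ⟨t₀⟩ := ‹Nonempty T›
  have : Nonempty I := ⟨c t₀⟩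
  set B : ℕ := ∑ i, ∑ x, r i x with hB
  have hrB : ∀ i x, r i x ≤ B := fun i x =>
    (Finset.single_le_sum (f := r i) (fun _ _ => Nat.zero_le _) (Finset.mem_univ x)).trans
      (Finset.single_le_sum (f := fun i => ∑ x, r i x) (fun _ _ => Nat.zero_le _)
        (Finset.mem_univ i))
  set r' : I → T ⊕ I → ℕ := fun i => Sum.elim (fun x => r i x + 1)
    (fun k => if k = i then 0 else B + 2 + Fintype.equivFin I k) with hr'
  have hr'inj : ∀ i, Function.Injective (r' i) := by
    rintro i (x | k) (y | l) h
    · simp only [hr', Sum.elim_inl, add_left_inj] at h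
      rw [hr i h]
    · have := hrB i x
      simp only [hr', Sum.elim_inl, Sum.elim_inr] at h
      split_ifs at h
      omega
    · have := hrB i y
      simp only [hr', Sum.elim_inl, Sum.elim_inr] at h
      split_ifs at h
      omega
    · simp only [hr', Sum.elim_inr] at h
      split_ifs at h with h1 h2 h2
      · rw [h1, h2]
      · omega
      · omega
      · have h3 : Fintype.equivFin I k = Fintype.equivFin I l := Fin.ext (by omega)
        rw [(Fintype.equivFin I).injective h3]
  obtain ⟨S, hS, hSc⟩ := exists_dominating_image_eq_univ hr'inj (Sum.elim c id) Sum.inr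
    (fun i => rfl)
    (by
      rintro i (x | k) hx
      · simp [hr']
      · have : k ≠ i := fun h => hx (by rw [h])
        simp [hr', this])
    (by
      rintro i k (x | l) hk hx
      · have := hrB i x
        simp only [hr', Sum.elim_inl, Sum.elim_inr, if_neg hk]
        omega
      · exact absurd rfl (hx l))
    ⟨Sum.inl t₀, fun l => Sum.inl_ne_inr⟩
  refine ⟨Finset.univ.filter fun x => Sum.inl x ∈ S, fun y => ?_⟩
  obtain ⟨i, hi⟩ := hS (Sum.inl y)
  have hiS : i ∈ S.image (Sum.elim c id) := by
    rw [hSc]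
    exact Finset.mem_univ _
  obtain ⟨x | k, hx, hxi⟩ := Finset.mem_image.1 hiS
  · simp only [Sum.elim_inl] at hxi
    refine ⟨x, by simpa using hx, fun x' hx' => ?_⟩
    have := hi (Sum.inl x') (by simpa using hx')
    simp only [hr', Sum.elim_inl, add_le_add_iff_right] at this
    rwa [hxi]
  · simp only [Sum.elim_inr, id] at hxi
    subst hxi
    have := hi _ hx
    simp [hr'] at this

/-- Any function to `ℕ` on a finite type can be refined to an injective one. -/
theorem exists_injective_refinement {T : Type*} [Fintype T] (f : T → ℕ) :
    ∃ g : T → ℕ, Function.Injective g ∧ ∀ x y, g x ≤ g y → f x ≤ f y := by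
  have hlt : ∀ x y, f x < f y → f x * Fintype.card T + Fintype.equivFin T x <
      f y * Fintype.card T + Fintype.equivFin T y := fun x y h => by
    have h1 := (Fintype.equivFin T x).2
    have h2 := Nat.mul_le_mul_right (Fintype.card T) (Nat.succ_le_of_lt h)
    rw [Nat.succ_mul] at h2
    omega
  refine ⟨fun x => f x * Fintype.card T + Fintype.equivFin T x, fun x y h => ?_, fun x y h => ?_⟩
  · have hf : f x = f y := by
      rcases lt_trichotomy (f x) (f y) with h' | h' | h'
      · exact absurd h (hlt x y h').ne
      · exact h'
      · exact absurd h (hlt y x h').ne'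
    simp only [hf, add_right_inj] at h
    exact (Fintype.equivFin T).injective (Fin.ext h)
  · by_contra! h'
    exact absurd h (not_le.2 (hlt y x h'))

theorem exists_approx_zero {ι : Type*} [Fintype ι] (φ : ι → (ι → ℝ≥0) → ℝ)
    (hzero : ∀ i s, s i = 0 → 0 < φ i s) (hone : ∀ i s, 1 < s i → φ i s < 0)
    {N : ℕ} (hN : 0 < N) :
    ∃ q : ι → ℝ≥0, q ≤ 2 ∧ (∀ i, φ i q ≤ 0) ∧
      ∀ i, ∃ s, dist s q ≤ Fintype.card ι / N ∧ 0 ≤ φ i s := by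
  classical
  have hN' : (0 : ℝ≥0) < N := by exact_mod_cast hN
  let p : (ι → Fin (2 * N + 1)) → ι → ℝ≥0 := fun x i => ((x i : ℕ) : ℝ≥0) / N
  have hcol : ∀ x, ∃ o : Option ι, (∀ i, o = some i → 0 ≤ φ i (p x)) ∧
      (o = none → ∀ i, φ i (p x) ≤ 0) := by
    intro x
    by_cases h : ∃ i, 0 ≤ φ i (p x)
    · obtain ⟨i, hi⟩ := h
      exact ⟨some i, fun j hj => by rwa [← Option.some.inj hj], fun h => by simp at h⟩
    · push Not at h
      exact ⟨none, fun j hj => by simp at hj, fun _ i => (h i).le⟩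
  choose c hcsome hcnone using hcol
  let f : Option ι → (ι → Fin (2 * N + 1)) → ℕ := fun o x =>
    o.elim (∑ i, (2 * N - (x i : ℕ))) fun i => (x i : ℕ)
  choose r hr hrf using fun o => exists_injective_refinement (f o)
  obtain ⟨σ, hσ⟩ := exists_dominating_for_own_colours r hr c
  replace hσ : ∀ y, ∃ x₀ ∈ σ, ∀ x ∈ σ, f (c x₀) y ≤ f (c x₀) x := fun y => by
    obtain ⟨x₀, hx₀, h⟩ := hσ y
    exact ⟨x₀, hx₀, fun x hx => hrf _ _ _ (h x hx)⟩
  have hle : ∀ x i, c x = some i → (x i : ℕ) ≤ N := by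
    intro x i hx
    by_contra! h
    refine absurd (hone i (p x) ?_) (not_lt.2 (hcsome x i hx))
    rw [one_lt_div hN']
    exact_mod_cast h
  obtain ⟨q, hq, hcq⟩ : ∃ q ∈ σ, c q = none := by
    obtain ⟨x₀, hx₀, h⟩ := hσ fun _ => Fin.last _
    refine ⟨x₀, hx₀, ?_⟩
    rcases hc : c x₀ with _ | i
    · rfl
    · have h1 := h x₀ hx₀
      have h2 := hle x₀ i hc
      simp only [hc, f, Option.elim, Fin.val_last] at h1
      omega
  have hν : ∀ i, ∃ ν : ℕ, ν ≤ N ∧ (∀ x ∈ σ, ν ≤ x i) ∧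
      ((∃ x ∈ σ, c x = some i) → ∃ x ∈ σ, (x i : ℕ) = ν) ∧
      ((¬ ∃ x ∈ σ, c x = some i) → ν = 0) := by
    intro i
    by_cases h : ∃ x ∈ σ, c x = some i
    · obtain ⟨x, hx, hxi⟩ := h
      obtain ⟨w, hw, hmin⟩ := σ.exists_min_image (fun x => (x i : ℕ)) ⟨x, hx⟩
      exact ⟨w i, (hmin x hx).trans (hle x i hxi), hmin, fun _ => ⟨w, hw, rfl⟩,
        fun h => absurd ⟨x, hx, hxi⟩ h⟩
    · exact ⟨0, Nat.zero_le _, fun _ _ => Nat.zero_le _, fun h' => absurd h' h, fun _ => rfl⟩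
  choose ν hνN hνle hνmin hνzero using hν
  have hsum : ∀ x ∈ σ, ∑ i, (x i : ℕ) ≤ ∑ i, ν i + Fintype.card ι := by
    obtain ⟨x₀, hx₀, h⟩ := hσ fun i => ⟨ν i + 1, by have := hνN i; omega⟩
    intro x hx
    rcases hc : c x₀ with _ | i
    · have h1 := h x hx
      simp only [hc, f, Option.elim] at h1
      have h2 : ∑ i, (2 * N - (x i : ℕ)) + ∑ i, (x i : ℕ) =
          ∑ i, (2 * N - (ν i + 1)) + ∑ i, (ν i + 1) := by
        rw [← Finset.sum_add_distrib, ← Finset.sum_add_distrib]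
        refine Finset.sum_congr rfl fun i _ => ?_
        have := hνN i
        have := (x i).2
        omega
      have h3 : ∑ i, (ν i + 1) = ∑ i, ν i + Fintype.card ι := by
        simp [Finset.sum_add_distrib]
      omega
    · obtain ⟨w, hw, hwν⟩ := hνmin i ⟨x₀, hx₀, hc⟩
      have h1 := h w hw
      simp only [hc, f, Option.elim] at h1
      omega
  have hupper : ∀ x ∈ σ, ∀ i, (x i : ℕ) ≤ ν i + Fintype.card ι := by
    intro x hx i
    have h1 := hsum x hx
    have h2 : ∑ j ∈ Finset.univ.erase i, ν j ≤ ∑ j ∈ Finset.univ.erase i, (x j : ℕ) :=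
      Finset.sum_le_sum fun j _ => hνle j x hx
    rw [← Finset.add_sum_erase _ _ (Finset.mem_univ i),
      ← Finset.add_sum_erase _ _ (Finset.mem_univ i)] at h1
    omega
  have hdist : ∀ a b : ℕ, a ≤ b + Fintype.card ι → b ≤ a + Fintype.card ι →
      dist ((a : ℝ≥0) / N) ((b : ℝ≥0) / N) ≤ (Fintype.card ι : ℝ) / N := by
    intro a b h1 h2
    have hNr : (0 : ℝ) < N := by exact_mod_cast hN
    have h1' : (a : ℝ) ≤ b + Fintype.card ι := by exact_mod_cast h1
    have h2' : (b : ℝ) ≤ a + Fintype.card ι := by exact_mod_cast h2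
    rw [NNReal.dist_eq]
    push_cast
    rw [← sub_div, abs_div, abs_of_pos hNr]
    gcongr
    rw [abs_le]
    constructor <;> linarith
  refine ⟨p q, fun i => ?_, hcnone q hcq, fun i => ?_⟩
  · change ((q i : ℕ) : ℝ≥0) / N ≤ 2
    rw [div_le_iff₀ hN']
    have := (q i).2
    exact_mod_cast (show (q i : ℕ) ≤ 2 * N by omega)
  · by_cases h : ∃ x ∈ σ, c x = some i
    · obtain ⟨x, hx, hxi⟩ := h
      refine ⟨p x, (dist_pi_le_iff (by positivity)).2 fun j => hdist _ _ ?_ ?_, hcsome x i hxi⟩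
      · exact (hupper x hx j).trans (by have := hνle j q hq; omega)
      · exact (hupper q hq j).trans (by have := hνle j x hx; omega)
    · refine ⟨Function.update (p q) i 0, (dist_pi_le_iff (by positivity)).2 fun j => ?_,
        (hzero i _ (by simp)).le⟩
      by_cases hj : j = i
      · subst hj
        have h1 := hupper q hq j
        rw [hνzero j h] at h1
        have h2 := hdist 0 (q j) (by omega) (by omega)
        simpa using h2
      · rw [Function.update_of_ne hj, dist_self]
        positivity

open Filter Topology in
/-- A form of the Poincaré–Miranda theorem. -/
theorem exists_common_zero {ι : Type*} [Fintype ι] (φ : ι → (ι → ℝ≥0) → ℝ)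
    (hφ : ∀ i, Continuous (φ i)) (hzero : ∀ i s, s i = 0 → 0 < φ i s)
    (hone : ∀ i s, 1 < s i → φ i s < 0) : ∃ s, ∀ i, φ i s = 0 := by
  choose q hq2 hqφ s hs hsφ using fun k : ℕ => exists_approx_zero φ hzero hone k.succ_pos
  obtain ⟨l, -, θ, hθ, hlim⟩ := (isCompact_Icc (a := (0 : ι → ℝ≥0)) (b := 2)).tendsto_subseq
    (x := q) fun k => ⟨zero_le, hq2 k⟩
  refine ⟨l, fun i => le_antisymm ?_ ?_⟩
  · exact le_of_tendsto (((hφ i).tendsto l).comp hlim) (.of_forall fun k => hqφ (θ k) i)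
  · have hd : Tendsto (fun k => dist (s k i) (q k)) atTop (𝓝 0) := by
      refine squeeze_zero (fun _ => dist_nonneg) (fun k => hs k i) ?_
      have := tendsto_const_div_atTop_nhds_zero_nat (Fintype.card ι : ℝ)
      exact (tendsto_add_atTop_iff_nat 1).2 this
    have hs' : Tendsto (fun k => s (θ k) i) atTop (𝓝 l) :=
      hlim.congr_dist (by
        simpa only [dist_comm, Function.comp_def] using hd.comp hθ.tendsto_atTop)
    exact ge_of_tendsto (((hφ i).tendsto l).comp hs') (.of_forall fun k => hsφ (θ k) i)

theorem PerfComp.monotone {m : ℕ} {u : Bundle m → ℝ} (hpc : PerfComp u) : Monotone u := by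
  intro x y hxy
  have := hpc x y
  rw [inf_eq_left.2 hxy] at this
  rw [this]
  exact min_le_right _ _

theorem PerfComp.exists_least {m : ℕ} {u : Bundle m → ℝ} (hcont : Continuous u)
    (hpc : PerfComp u) (b : Bundle m) : ∃ x, u b ≤ u x ∧ ∀ y, u b ≤ u y → x ≤ y := by
  have hK : IsCompact (Set.Icc 0 b ∩ {y | u b ≤ u y}) :=
    isCompact_Icc.inter_right (isClosed_le continuous_const hcont)
  obtain ⟨x, ⟨⟨-, hxb⟩, hux⟩, hmin⟩ := hK.exists_isMinOn (f := fun y : Bundle m => ∑ j, y j)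
    ⟨b, ⟨zero_le, le_rfl⟩, le_refl (u b)⟩ (by fun_prop)
  refine ⟨x, hux, fun y hy => ?_⟩
  have hinf : u b ≤ u (x ⊓ y) := by
    rw [hpc]
    exact le_min hux hy
  have hsum : ∑ j, x j ≤ ∑ j, (x ⊓ y) j := hmin ⟨⟨zero_le, inf_le_left.trans hxb⟩, hinf⟩
  have heq := (Finset.sum_eq_sum_iff_of_le fun j _ => (inf_le_left : x ⊓ y ≤ x) j).1
    (le_antisymm (Finset.sum_le_sum fun j _ => (inf_le_left : x ⊓ y ≤ x) j) hsum)
  intro j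
  rw [← heq j (Finset.mem_univ j)]
  exact min_le_right _ _

/-- The parsimonious bundles form a continuous path, which can be parametrized by the largest
coordinate. -/
theorem PerfComp.exists_parsimonious_path {m : ℕ} {u : Bundle m → ℝ} (hcont : Continuous u)
    (hmono : ∀ x y : Bundle m, (∀ j, x j < y j) → u x < u y) (hpc : PerfComp u) :
    ∃ c : ℝ≥0 → Bundle m, Continuous c ∧ ∀ s, Parsimonious u (c s) ∧ (∀ j, c s j ≤ s) ∧
      ∃ j, s ≤ c s j := by
  set d : ℝ≥0 → Bundle m := fun s _ => s with hd
  have hdcont : Continuous fun s => u (d s) := hcont.comp (by fun_prop)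
  have hdmono : Monotone fun s => u (d s) := fun s t h => hpc.monotone fun _ => h
  choose c hc hleast using fun s => hpc.exists_least hcont (d s)
  have hcd : ∀ s, c s ≤ d s := fun s => hleast s _ le_rfl
  have hcu : ∀ s, u (c s) = u (d s) := fun s => le_antisymm (hpc.monotone (hcd s)) (hc s)
  have hcmono : Monotone c := fun s t h => hleast s _ ((hdmono h).trans (hc t))
  refine ⟨c, continuous_pi fun j => continuous_iff_continuousAt.2 fun s => ?_, fun s =>
    ⟨fun z hz hne => ?_, hcd s, ?_⟩⟩
  · refine tendsto_order.2 ⟨fun a ha => ?_, fun b hb => ?_⟩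
    · have hz : u (Function.update (c s) j a) < u (d s) := by
        by_contra! h
        have := hleast s _ h j
        rw [Function.update_self] at this
        exact absurd this (not_le.2 ha)
      filter_upwards [hdcont.continuousAt.eventually_const_lt hz] with t ht
      by_contra! h
      rcases le_total s t with hst | hts
      · exact absurd (ha.trans_le (hcmono hst j)) (not_lt.2 h)
      · refine absurd (ht.trans_le (hc t)) (not_lt.2 (hpc.monotone fun k => ?_))
        by_cases hk : k = j
        · subst hk
          rwa [Function.update_self]
        · rw [Function.update_of_ne hk]
          exact hcmono hts k
    · obtain ⟨b', hb1, hb2⟩ := exists_between hb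
      obtain ⟨b'', hb3, hb4⟩ := exists_between hb2
      have hz : u (d s) < u (Function.update (d (s + 2)) j b'') := by
        refine lt_of_le_of_lt ?_ (hmono (Function.update (d (s + 1)) j b') _ fun k => ?_)
        · refine (hc s).trans (hpc.monotone fun k => ?_)
          by_cases hk : k = j
          · subst hk
            rw [Function.update_self]
            exact hb1.le
          · rw [Function.update_of_ne hk]
            exact (hcd s k).trans (by simp [hd])
        · by_cases hk : k = j
          · subst hk
            rwa [Function.update_self, Function.update_self]
          · rw [Function.update_of_ne hk, Function.update_of_ne hk]
            simp only [hd]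
            gcongr
            exact one_lt_two
      filter_upwards [hdcont.continuousAt.eventually_lt_const hz] with t ht
      have := hleast t _ ht.le j
      rw [Function.update_self] at this
      exact this.trans_lt hb4
  · by_contra! h
    exact hne (le_antisymm hz (hleast s z ((hc s).trans h)))
  · by_contra! h
    exact absurd (hmono _ _ h) (not_lt.2 (hc s))

/-- If all utilities are continuous, strictly monotonic, non-satiable and perfectly
complementary, then a bottleneck-based fair allocation (one with the 'No Justified
Complaints' property) exists: all bundles are parsimonious and every agent is either
satiated or gets at least his entitlement of some bottleneck good. -/
theorem exists_BBF_allocation {n m : ℕ} (u : Fin n → Bundle m → ℝ)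
    (hcont : ∀ i, Continuous (u i)) (hns : ∀ i, NonSatiableStrictMono (u i))
    (hpc : ∀ i, PerfComp (u i))
    (e : Fin n → ℝ≥0) (he : ∀ i, 0 < e i) (hesum : ∑ i, e i = 1) :
    ∃ X : Fin n → Bundle m, (∀ j, ∑ i, X i j ≤ 1) ∧
      ∀ i, Parsimonious (u i) (X i) ∧
        (Maximal' (u i) (X i) ∨ ∃ j, (∑ k, X k j = 1) ∧ e i ≤ X i j) := by
  choose c hc hpars hle hge using fun i =>
    (hpc i).exists_parsimonious_path (hcont i) (hns i).2
  have hgoods : (Finset.univ : Finset (Fin m)).Nonempty := by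
    rcases Finset.eq_empty_or_nonempty (Finset.univ : Finset (Fin n)) with h | ⟨i, -⟩
    · rw [h, Finset.sum_empty] at hesum
      exact absurd hesum zero_ne_one
    · exact ⟨(hge i 0).choose, Finset.mem_univ _⟩
  set ψ : Fin n → (Fin n → ℝ≥0) → Fin m → ℝ := fun i s j =>
    max (1 - ∑ k, (c k (s k) j : ℝ)) (e i - c i (s i) j) with hψ
  have hcj : ∀ k j, Continuous fun s : Fin n → ℝ≥0 => (c k (s k) j : ℝ) := fun k j =>
    NNReal.continuous_coe.comp
      ((continuous_apply j).comp ((hc k).comp (continuous_apply k)))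
  obtain ⟨s, hs⟩ := exists_common_zero (fun i s => Finset.univ.inf' hgoods (ψ i s))
    (fun i => Continuous.finset_inf'_apply hgoods fun j _ =>
      (continuous_const.sub (continuous_finsetSum _ fun k _ => hcj k j)).max
        (continuous_const.sub (hcj i j)))
    (fun i s hsi => by
      refine (Finset.lt_inf'_iff _).2 fun j _ => lt_max_of_lt_right ?_
      have h := hle i (s i) j
      rw [hsi, nonpos_iff_eq_zero] at h
      rw [hsi, h, NNReal.coe_zero, sub_zero]
      exact_mod_cast he i)
    (fun i s hsi => by
      obtain ⟨j, hj⟩ := hge i (s i)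
      refine (Finset.inf'_lt_iff _).2 ⟨j, Finset.mem_univ _, max_lt ?_ ?_⟩
      · have h1 : c i (s i) j ≤ ∑ k, c k (s k) j :=
          Finset.single_le_sum (f := fun k => c k (s k) j) (fun _ _ => zero_le)
            (Finset.mem_univ i)
        have h2 : (1 : ℝ≥0) < ∑ k, c k (s k) j := hsi.trans_le (hj.trans h1)
        rw [sub_neg]
        exact_mod_cast h2
      · have h1 : e i ≤ 1 := hesum ▸
          Finset.single_le_sum (f := e) (fun _ _ => zero_le) (Finset.mem_univ i)
        rw [sub_neg]
        exact_mod_cast h1.trans_lt (hsi.trans_le hj))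
  have hfeas : ∀ j, ∑ k, c k (s k) j ≤ 1 := by
    intro j
    by_contra! h
    refine absurd h (not_lt.2 (hesum ▸ Finset.sum_le_sum fun k _ => ?_))
    have h1 : (0 : ℝ) ≤ ψ k s j := hs k ▸ Finset.inf'_le _ (Finset.mem_univ j)
    rcases le_max_iff.1 h1 with h2 | h2
    · rw [sub_nonneg] at h2
      exact absurd (show ∑ k, c k (s k) j ≤ 1 by exact_mod_cast h2) (not_le.2 h)
    · rw [sub_nonneg] at h2
      exact_mod_cast h2
  refine ⟨fun i => c i (s i), hfeas, fun i => ⟨hpars i _, Or.inr ?_⟩⟩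
  obtain ⟨j, -, hj⟩ := Finset.exists_mem_eq_inf' hgoods (ψ i s)
  have h0 : ψ i s j ≤ 0 := by rw [← hj, hs i]
  obtain ⟨h1, h2⟩ := max_le_iff.1 h0
  rw [sub_nonpos] at h1 h2
  exact ⟨j, le_antisymm (hfeas j) (by exact_mod_cast h1), by exact_mod_cast h2⟩
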